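/- Fix an integer m ≥ 1 and n with 2 ≤ n ≤ ∞, and let Γ and the cost function c be as in the context. Then any directed path in Γ from the vertex −(2m+1) to the vertex 2m+1, all of whose intermediate vertices are a-vertices, has cost at least 1. -/

import Mathlib

/-- The vertex set `V = {i ∈ ℤ : 1 ≤ |i| ≤ 2m+1}`. -/
def memV (m i : ℤ) : Prop := 1 ≤ |i| ∧ |i| ≤ 2 * m + 1

/-- `i` is an `a`-vertex: `|i|` odd and `|i| ≤ 2m - 1`. -/
def isA (m i : ℤ) : Prop := Odd |i| ∧ |i| ≤ 2 * m - 1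

/-- `i` is a `b`-vertex: `|i|` even. -/
def isB (i : ℤ) : Prop := Even i

/-- The start-side of a vertex: `true` = `P`, `false` = `N`. -/
def startSide (m i : ℤ) : Bool :=
  if i = 2 * m + 1 then true
  else if i = -(2 * m + 1) then false
  else if i % 2 = 0 then false else true

/-- The end-side of a vertex: `true` = `P`, `false` = `N`. -/
def endSide (m i : ℤ) : Bool :=
  if i = 2 * m + 1 then false
  else if i = -(2 * m + 1) then true
  else if i % 2 = 0 then false else true

/-- `(u, v)` is a directed edge of `Γ`: both are vertices and the end-side of `u`
equals the start-side of `v`. -/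
def isEdge (m u v : ℤ) : Prop := memV m u ∧ memV m v ∧ endSide m u = startSide m v

/-- The real number `1/n` for `n : ℕ∞`, with the convention `1/∞ = 0`. -/
noncomputable def invE (n : ℕ∞) : ℝ := ((n.toNat : ℝ))⁻¹

/-- The cost function `c` on ordered pairs of vertices:
for `1 ≤ i, j ≤ 2m+1`, `c(i,j) = 1 - 1/n` if `i < j`, `1/n` if `j ≤ i < 2m+1`, `0` if
`i = 2m+1`; `c(i,-j) = 0` if `i = 2m+1` or `j = 2m+1` or `i = j = 2m`, else `1 - 1/n`;
`c(-i,j) = 1` if `i = j = 2m+1`, `2/n - 1` if `i = j = 1`, else `1/n`;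
`c(-i,-j) = 1 - 1/n` if `i > j`, `1/n` if `i ≤ j < 2m+1`, `0` if `j = 2m+1`. -/
noncomputable def cost (m : ℤ) (n : ℕ∞) (u v : ℤ) : ℝ :=
  if 0 < u then
    if 0 < v then
      if u = 2 * m + 1 then 0
      else if u < v then 1 - invE n
      else invE n
    else
      if u = 2 * m + 1 ∨ v = -(2 * m + 1) ∨ (u = 2 * m ∧ v = -(2 * m)) then 0
      else 1 - invE n
  else
    if 0 < v then
      if u = -(2 * m + 1) ∧ v = 2 * m + 1 then 1
      else if u = -1 ∧ v = 1 then 2 * invE n - 1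
      else invE n
    else
      if v = -(2 * m + 1) then 0
      else if u < v then 1 - invE n
      else invE n

/-- Lower bound for the cost of a path from `-(2m+1)` to `w`. -/
noncomputable def pot (m : ℤ) (e : ℝ) (w : ℤ) : ℝ :=
  if w = 2 * m + 1 then 1 else if w = -(2 * m + 1) then 0 else if 0 < w then e else 1 - e

theorem invE_bounds (n : ℕ∞) (hn : 2 ≤ n) : 0 ≤ invE n ∧ invE n ≤ 1 / 2 := by
  unfold invE
  refine ⟨by positivity, ?_⟩
  induction n using ENat.recTopCoe with
  | top => simp
  | coe k =>
    have hk : 2 ≤ k := by exact_mod_cast hn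
    have hk' : (2 : ℝ) ≤ k := by exact_mod_cast hk
    rw [ENat.toNat_coe, one_div]
    exact inv_anti₀ (by norm_num) hk'

theorem isA_bounds {m w : ℤ} (h : isA m w) : w ≠ 0 ∧ w < 2 * m ∧ -(2 * m) < w := by
  obtain ⟨h1, h2⟩ := h
  have := abs_le.mp h2
  refine ⟨?_, by omega, by omega⟩
  rintro rfl
  simp at h1

theorem pot_step (m : ℤ) (hm : 1 ≤ m) (n : ℕ∞) (hn : 2 ≤ n) (u w : ℤ)
    (hu : u = -(2 * m + 1) ∨ isA m u) (hw : w = 2 * m + 1 ∨ isA m w) :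
    pot m (invE n) w ≤ pot m (invE n) u + cost m n u w := by
  obtain ⟨h0, h1⟩ := invE_bounds n hn
  have hu' : u = -(2 * m + 1) ∨ (u ≠ 0 ∧ u < 2 * m ∧ -(2 * m) < u) := hu.imp id isA_bounds
  have hw' : w = 2 * m + 1 ∨ (w ≠ 0 ∧ w < 2 * m ∧ -(2 * m) < w) := hw.imp id isA_bounds
  clear hu hw
  unfold pot cost
  split_ifs <;> first | linarith | (exfalso; omega)

/-- Any directed path in `Γ` from `-(2m+1)` to `2m+1` all of whose intermediate vertices are
`a`-vertices has cost at least `1`. -/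
theorem stmt18 (m : ℤ) (hm : 1 ≤ m) (n : ℕ∞) (hn : 2 ≤ n)
    (L : ℕ) (v : ℕ → ℤ)
    (hstart : v 0 = -(2 * m + 1)) (hend : v L = 2 * m + 1)
    (hedge : ∀ i < L, isEdge m (v i) (v (i + 1)))
    (hA : ∀ i, 0 < i → i < L → isA m (v i)) :
    1 ≤ ∑ i ∈ Finset.range L, cost m n (v i) (v (i + 1)) := by
  have key : ∀ k ≤ L, pot m (invE n) (v k) ≤
      ∑ i ∈ Finset.range k, cost m n (v i) (v (i + 1)) := by
    intro k
    induction k with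
    | zero =>
      intro _
      rw [hstart, pot, if_neg (by omega), if_pos rfl]
      simp
    | succ k ih =>
      intro hk
      rw [Finset.sum_range_succ]
      have h1 : v k = -(2 * m + 1) ∨ isA m (v k) := by
        rcases Nat.eq_zero_or_pos k with rfl | h
        · exact Or.inl hstart
        · exact Or.inr (hA k h (by omega))
      have h2 : v (k + 1) = 2 * m + 1 ∨ isA m (v (k + 1)) := by
        rcases Nat.lt_or_ge (k + 1) L with h | h
        · exact Or.inr (hA _ (by omega) h)
        · obtain rfl : k + 1 = L := by omega
          exact Or.inl hend
      have := pot_step m hm n hn _ _ h1 h2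
      have := ih (by omega)
      linarith
  have h := key L le_rfl
  rwa [hend, pot, if_pos rfl] at h
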